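/- The limits lim_{L→∞} (1/L) log |Ω_L^PSAW| and lim_{L→∞} (1/L) log |Ω_L^NE| both exist and are equal: the exponential growth rate of the number of generic prudent paths equals that of two-sided (NE) prudent paths. -/

import Mathlib

open Filter

/-! ## Paths on `ℤ²` encoded by direction sequences -/

/-- The four unit steps of `ℤ²`: right, left, up, down. -/
def dirs : Fin 4 → ℤ × ℤ := ![(1, 0), (-1, 0), (0, 1), (0, -1)]

/-- The list of steps (increments) of an `L`-step path encoded by a direction sequence. -/
def stepsOf {L : ℕ} (s : Fin L → Fin 4) : List (ℤ × ℤ) := (List.ofFn s).map dirs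

/-- The position `w_i` of the path after `i` steps; `w_0 = (0,0)`. -/
def pt (steps : List (ℤ × ℤ)) (i : ℕ) : ℤ × ℤ := (steps.take i).sum

/-- Self-avoiding: the sites `w_0, …, w_L` are pairwise distinct. -/
def IsSA (steps : List (ℤ × ℤ)) : Prop :=
  ∀ i ≤ steps.length, ∀ j ≤ steps.length, pt steps i = pt steps j → i = j

/-- Prudent: no step points towards a previously visited site, i.e. for every
`i < L`, every `k ≥ 1` and every `j ≤ i`, `w_i + k (w_{i+1} - w_i) ≠ w_j`. -/
def IsPrudent (steps : List (ℤ × ℤ)) : Prop :=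
  ∀ i < steps.length, ∀ k : ℕ, 1 ≤ k → ∀ j ≤ i,
    pt steps i + (k : ℤ) • steps.getD i (0, 0) ≠ pt steps j

/-- Twice the midpoint `u_{i+1}` of step number `i` (0-indexed): `w_i + w_{i+1}`. -/
def dmid (steps : List (ℤ × ℤ)) (i : ℕ) : ℤ × ℤ := pt steps i + pt steps (i + 1)

/-- The Hamiltonian `H(w)`: the number of pairs `1 ≤ i < j ≤ L` with
`‖u_i - u_j‖ = 1`, i.e. whose doubled midpoints differ by a vector of squared
Euclidean norm `4`. -/
noncomputable def Ham (steps : List (ℤ × ℤ)) : ℕ :=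
  ((Finset.range steps.length ×ˢ Finset.range steps.length).filter fun p =>
      p.1 < p.2 ∧ (dmid steps p.1 - dmid steps p.2).1 ^ 2 +
        (dmid steps p.1 - dmid steps p.2).2 ^ 2 = 4).card

/-! ## IPSAW -/

open scoped Classical in
/-- `Ω_L^PSAW`: the set of `L`-step prudent paths. -/
noncomputable def psawFinset (L : ℕ) : Finset (Fin L → Fin 4) :=
  Finset.univ.filter fun s => IsPrudent (stepsOf s)

/-- `Z_{β,L}`: the partition function of IPSAW. -/
noncomputable def Zpsaw (β : ℝ) (L : ℕ) : ℝ :=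
  ∑ s ∈ psawFinset L, Real.exp (β * (Ham (stepsOf s) : ℝ))

/-! ## Partially directed paths, oriented blocks and NE-prudent paths -/

/-- The vertical run of steps corresponding to a (signed) stretch `ℓ`. -/
def vrun (ℓ : ℤ) : List (ℤ × ℤ) := List.replicate ℓ.natAbs (if 0 ≤ ℓ then (0, 1) else (0, -1))

/-- The horizontal run of steps corresponding to a (signed) stretch `ℓ`. -/
def hrun (ℓ : ℤ) : List (ℤ × ℤ) := List.replicate ℓ.natAbs (if 0 ≤ ℓ then (1, 0) else (-1, 0))

/-- The west-east partially directed path with stretch sequence `ℓs`: vertical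
runs separated by single horizontal inter-stretch steps. -/
def weSteps (ℓs : List ℤ) : List (ℤ × ℤ) := List.intercalate [(1, 0)] (ℓs.map vrun)

/-- The south-north partially directed path with stretch sequence `ℓs`: horizontal
runs separated by single vertical inter-stretch steps. -/
def snSteps (ℓs : List ℤ) : List (ℤ × ℤ) := List.intercalate [(0, 1)] (ℓs.map hrun)

/-- The upper exit condition: `ℓ_1 + ⋯ + ℓ_N > max_{0 ≤ i < N} (ℓ_1 + ⋯ + ℓ_i)`. -/
def upperExit (ℓs : List ℤ) : Prop := ∀ i < ℓs.length, (ℓs.take i).sum < ℓs.sum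

/-- A block of given type: `true` = west-east, `false` = south-north. -/
def blockSteps : Bool → List ℤ → List (ℤ × ℤ)
  | true, ℓs => weSteps ℓs
  | false, ℓs => snSteps ℓs

/-- The concatenation of a sequence of blocks of alternating type, starting with
type `b`. -/
def neSteps : Bool → List (List ℤ) → List (ℤ × ℤ)
  | _, [] => []
  | b, ℓs :: rest => blockSteps b ℓs ++ neSteps (!b) rest

/-- Block data of an NE-prudent path: a nonempty sequence of nonempty stretch
sequences, all blocks but the last satisfying the upper exit condition, and all
blocks but the first having a negative first stretch. -/
def IsNEData (bs : List (List ℤ)) : Prop :=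
  bs ≠ [] ∧ (∀ ℓs ∈ bs, ℓs ≠ []) ∧
  (∀ i : ℕ, i + 1 < bs.length → upperExit (bs.getD i [])) ∧
  (∀ i : ℕ, 0 < i → i < bs.length → (bs.getD i []).headI < 0)

/-- An NE-prudent path: a prudent path obtained as the concatenation of oriented
blocks of alternating type as prescribed by `IsNEData`. -/
def IsNEPath (steps : List (ℤ × ℤ)) : Prop :=
  IsPrudent steps ∧ ∃ (b : Bool) (bs : List (List ℤ)), IsNEData bs ∧ neSteps b bs = steps

open scoped Classical in
/-- `Ω_L^NE`: the set of `L`-step NE-prudent paths. -/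
noncomputable def neFinset (L : ℕ) : Finset (Fin L → Fin 4) :=
  Finset.univ.filter fun s => IsNEPath (stepsOf s)

/-- `Z^NE_{β,L}`: the partition function of NE-IPSAW. -/
noncomputable def Zne (β : ℝ) (L : ℕ) : ℝ :=
  ∑ s ∈ neFinset L, Real.exp (β * (Ham (stepsOf s) : ℝ))

/-! ## Starred and tilde NE sets -/

/-- Block data where all blocks, including the last one, satisfy the upper exit
condition. -/
def IsNEStarData (bs : List (List ℤ)) : Prop :=
  bs ≠ [] ∧ (∀ ℓs ∈ bs, ℓs ≠ []) ∧
  (∀ i : ℕ, i < bs.length → upperExit (bs.getD i [])) ∧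
  (∀ i : ℕ, 0 < i → i < bs.length → (bs.getD i []).headI < 0)

/-- Membership in `Ω_L^{NE,*}`. -/
def IsNEStar (steps : List (ℤ × ℤ)) : Prop :=
  IsPrudent steps ∧ ∃ (b : Bool) (bs : List (List ℤ)), IsNEStarData bs ∧ neSteps b bs = steps

/-- Membership in `Ω̃_L^{NE,*}`: moreover the first stretch of the path has length `0`. -/
def IsNETilde (steps : List (ℤ × ℤ)) : Prop :=
  IsPrudent steps ∧ ∃ (b : Bool) (bs : List (List ℤ)), IsNEStarData bs ∧
    bs.headI.headI = 0 ∧ neSteps b bs = steps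

open scoped Classical in
noncomputable def neStarFinset (L : ℕ) : Finset (Fin L → Fin 4) :=
  Finset.univ.filter fun s => IsNEStar (stepsOf s)

open scoped Classical in
noncomputable def neTildeFinset (L : ℕ) : Finset (Fin L → Fin 4) :=
  Finset.univ.filter fun s => IsNETilde (stepsOf s)

/-- `Z^{NE,*}_{β,L}`. -/
noncomputable def Zstar (β : ℝ) (L : ℕ) : ℝ :=
  ∑ s ∈ neStarFinset L, Real.exp (β * (Ham (stepsOf s) : ℝ))

/-- `Z̃^{NE,*}_{β,L}`. -/
noncomputable def Ztilde (β : ℝ) (L : ℕ) : ℝ :=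
  ∑ s ∈ neTildeFinset L, Real.exp (β * (Ham (stepsOf s) : ℝ))

/-! ## IPDSAW and ISAW -/

/-- A west-east partially directed self-avoiding path: increments in
`{(1,0),(0,1),(0,-1)}` and self-avoiding. -/
def IsPD (steps : List (ℤ × ℤ)) : Prop :=
  (∀ d ∈ steps, d = (1, 0) ∨ d = (0, 1) ∨ d = (0, -1)) ∧ IsSA steps

open scoped Classical in
/-- `Ω_L^PDSAW`. -/
noncomputable def pdFinset (L : ℕ) : Finset (Fin L → Fin 4) :=
  Finset.univ.filter fun s => IsPD (stepsOf s)

/-- `Z^IPDSAW_{β,L}`. -/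
noncomputable def Zipd (β : ℝ) (L : ℕ) : ℝ :=
  ∑ s ∈ pdFinset L, Real.exp (β * (Ham (stepsOf s) : ℝ))

open scoped Classical in
/-- `Ω_L^SAW`. -/
noncomputable def sawFinset (L : ℕ) : Finset (Fin L → Fin 4) :=
  Finset.univ.filter fun s => IsSA (stepsOf s)

/-- `Z^ISAW_{β,L}`. -/
noncomputable def Zisaw (β : ℝ) (L : ℕ) : ℝ :=
  ∑ s ∈ sawFinset L, Real.exp (β * (Ham (stepsOf s) : ℝ))

/-! ## Orientations of two-sided paths -/

/-- The four possible general orientations of a two-sided prudent path. -/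
inductive Orient | NE | NW | SE | SW
deriving DecidableEq

/-- The axial symmetry of `ℤ²` turning an NE-oriented object into an
`x`-oriented one, acting on steps. -/
def osym : Orient → ℤ × ℤ → ℤ × ℤ
  | Orient.NE, d => d
  | Orient.NW, d => (-d.1, d.2)
  | Orient.SE, d => (d.1, -d.2)
  | Orient.SW, d => (-d.1, -d.2)

/-! ## Prudent coordinate functions -/

/-- `t` is a record time of `f`: the value `f t` is at least every earlier value. -/
def Rec (f : ℕ → ℤ) (t : ℕ) : Prop := ∀ j ≤ t, f j ≤ f t

/-- The coordinate functions `X`, `Y` describe a prudent path during the first `n` steps. -/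
structure PrudentXY (X Y : ℕ → ℤ) (n : ℕ) : Prop where
  step : ∀ i < n, (Y (i + 1) = Y i ∧ (X (i + 1) = X i + 1 ∨ X (i + 1) = X i - 1)) ∨
    (X (i + 1) = X i ∧ (Y (i + 1) = Y i + 1 ∨ Y (i + 1) = Y i - 1))
  east : ∀ i < n, X (i + 1) = X i + 1 → ∀ j ≤ i, Y j = Y i → X j ≤ X i
  west : ∀ i < n, X (i + 1) = X i - 1 → ∀ j ≤ i, Y j = Y i → X i ≤ X j
  north : ∀ i < n, Y (i + 1) = Y i + 1 → ∀ j ≤ i, X j = X i → Y j ≤ Y i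
  south : ∀ i < n, Y (i + 1) = Y i - 1 → ∀ j ≤ i, X j = X i → Y i ≤ Y j

namespace PrudentXY

variable {X Y : ℕ → ℤ} {n : ℕ}

theorem swap (h : PrudentXY X Y n) : PrudentXY Y X n where
  step i hi := by have := h.step i hi; tauto
  east := h.north
  west := h.south
  north := h.east
  south := h.west

theorem negX (h : PrudentXY X Y n) : PrudentXY (fun t => -X t) Y n where
  step i hi := by have := h.step i hi; grind
  east i hi hs j hj hy := by have := h.west i hi (by linarith) j hj hy; linarith
  west i hi hs j hj hy := by have := h.east i hi (by linarith) j hj hy; linarith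
  north i hi hs j hj hy := h.north i hi hs j hj (by linarith)
  south i hi hs j hj hy := h.south i hi hs j hj (by linarith)

theorem negY (h : PrudentXY X Y n) : PrudentXY X (fun t => -Y t) n := h.swap.negX.swap

theorem window (h : PrudentXY X Y n) {X' Y' : ℕ → ℤ} {a m : ℕ} {c d : ℤ} (ha : a + m ≤ n)
    (hX : ∀ t ≤ m, X' t = X (a + t) - c) (hY : ∀ t ≤ m, Y' t = Y (a + t) - d) :
    PrudentXY X' Y' m where
  step i hi := by
    have := h.step (a + i) (by omega)
    rw [hX (i + 1) hi, hX i hi.le, hY (i + 1) hi, hY i hi.le, ← add_assoc]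
    omega
  east i hi hs j hj hy := by
    rw [hX (i + 1) hi, hX i hi.le, ← add_assoc] at hs
    rw [hY i hi.le, hY j (by omega)] at hy
    rw [hX i hi.le, hX j (by omega)]
    have := h.east (a + i) (by omega) (by omega) (a + j) (by omega) (by omega)
    omega
  west i hi hs j hj hy := by
    rw [hX (i + 1) hi, hX i hi.le, ← add_assoc] at hs
    rw [hY i hi.le, hY j (by omega)] at hy
    rw [hX i hi.le, hX j (by omega)]
    have := h.west (a + i) (by omega) (by omega) (a + j) (by omega) (by omega)
    omega
  north i hi hs j hj hy := by
    rw [hY (i + 1) hi, hY i hi.le, ← add_assoc] at hs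
    rw [hX i hi.le, hX j (by omega)] at hy
    rw [hY i hi.le, hY j (by omega)]
    have := h.north (a + i) (by omega) (by omega) (a + j) (by omega) (by omega)
    omega
  south i hi hs j hj hy := by
    rw [hY (i + 1) hi, hY i hi.le, ← add_assoc] at hs
    rw [hX i hi.le, hX j (by omega)] at hy
    rw [hY i hi.le, hY j (by omega)]
    have := h.south (a + i) (by omega) (by omega) (a + j) (by omega) (by omega)
    omega

/-- Prudent paths are self-avoiding. -/
theorem injective (h : PrudentXY X Y n) {i j : ℕ} (hi : i ≤ n) (hj : j ≤ n)
    (hX : X i = X j) (hY : Y i = Y j) : i = j := by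
  by_contra hne
  wlog hlt : j < i generalizing i j
  · exact this hj hi hX.symm hY.symm (Ne.symm hne) (by omega)
  obtain ⟨k, rfl⟩ : ∃ k, i = k + 1 := ⟨i - 1, by omega⟩
  have hk : k < n := by omega
  have hjk : j ≤ k := by omega
  rcases h.step k hk with ⟨h1, h2 | h2⟩ | ⟨h1, h2 | h2⟩
  · have := h.east k hk h2 j hjk (by omega); omega
  · have := h.west k hk h2 j hjk (by omega); omega
  · have := h.north k hk h2 j hjk (by omega); omega
  · have := h.south k hk h2 j hjk (by omega); omega

theorem abs_sub_le (h : PrudentXY X Y n) {i : ℕ} (m : ℕ) (hi : i + m ≤ n) :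
    |X (i + m) - X i| ≤ m := by
  induction m with
  | zero => simp
  | succ m ih =>
    have h1 := ih (by omega)
    have h2 := h.step (i + m) (by omega)
    rw [abs_le] at *
    push_cast
    rw [← add_assoc]
    omega

end PrudentXY

/-- A discrete intermediate value theorem, as a statement on an interval of times. -/
theorem exists_eq_of_unit_steps {f : ℕ → ℤ} {c : ℤ} {i : ℕ} (m : ℕ)
    (hf : ∀ k < i + m, |f (k + 1) - f k| ≤ 1) (hi : f i < c) (hm : c < f (i + m)) :
    ∃ j < i + m, f j = c := by
  induction m with
  | zero => simp at hm; omega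
  | succ m ih =>
    rcases lt_trichotomy c (f (i + m)) with hlt | heq | hgt
    · obtain ⟨j, hj, hjc⟩ := ih (fun k hk => hf k (by omega)) hlt
      exact ⟨j, by omega, hjc⟩
    · exact ⟨i + m, by omega, heq.symm⟩
    · have := hf (i + m) (by omega)
      rw [abs_le] at this
      rw [← add_assoc] at hm
      omega

theorem not_rec {f : ℕ → ℤ} {t : ℕ} : ¬ Rec f t ↔ ∃ j ≤ t, f t < f j := by
  simp [Rec]

namespace PrudentXY

variable {X Y : ℕ → ℤ} {n : ℕ}

/-- A row lying strictly between the lowest and the highest visited rows has been visited. -/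
theorem exists_earlier_row (h : PrudentXY X Y n) {t : ℕ} (ht : t ≤ n) (hN : ¬ Rec Y t)
    (hS : ¬ Rec (fun s => -Y s) t) : ∃ j < t, Y j = Y t := by
  have hstep : ∀ k < t, |Y (k + 1) - Y k| ≤ 1 := fun k hk => by
    simpa using h.swap.abs_sub_le (i := k) 1 (by omega)
  obtain ⟨j₁, hj₁, h₁⟩ := not_rec.1 hN
  obtain ⟨j₂, hj₂, h₂⟩ := not_rec.1 hS
  simp only [neg_lt_neg_iff] at h₂
  rcases lt_trichotomy j₁ j₂ with hlt | heq | hgt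
  · obtain ⟨m, rfl⟩ := Nat.exists_eq_add_of_le hlt.le
    obtain ⟨j, hj, hjc⟩ := exists_eq_of_unit_steps (f := fun s => -Y s) (c := -Y t) (i := j₁) m
      (fun k hk => by
        have := hstep k (by omega)
        rw [abs_le] at *; omega) (by simpa using h₁) (by simpa using h₂)
    exact ⟨j, by omega, by simpa using hjc⟩
  · subst heq; omega
  · obtain ⟨m, rfl⟩ := Nat.exists_eq_add_of_le hgt.le
    obtain ⟨j, hj, hjc⟩ := exists_eq_of_unit_steps (f := Y) (c := Y t) (i := j₂) m
      (fun k hk => hstep k (by omega)) h₂ h₁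
    exact ⟨j, by omega, hjc⟩

/-- On the east side, strictly between the top and the bottom rows, no west step is possible. -/
theorem not_west (h : PrudentXY X Y n) {t : ℕ} (ht : t < n) (hN : ¬ Rec Y t)
    (hS : ¬ Rec (fun s => -Y s) t) (hE : Rec X t) : X (t + 1) ≠ X t - 1 := by
  intro hw
  obtain ⟨j, hj, hjY⟩ := h.exists_earlier_row ht.le hN hS
  have h1 := h.west t ht hw j hj.le hjY
  have h2 := hE j hj.le
  have := h.injective (by omega) ht.le (le_antisymm h2 h1) hjY
  omega

/-- On the west side, strictly between the top and the bottom rows, no east step is possible. -/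
theorem not_east (h : PrudentXY X Y n) {t : ℕ} (ht : t < n) (hN : ¬ Rec Y t)
    (hS : ¬ Rec (fun s => -Y s) t) (hW : Rec (fun s => -X s) t) : X (t + 1) ≠ X t + 1 := by
  have := h.negX.not_west ht hN hS hW
  intro h'
  exact this (by simp only [h']; ring)

theorem boundary_of_horizontal (h : PrudentXY X Y n) {t : ℕ} (ht : t < n)
    (ih : Rec Y t ∨ Rec (fun s => -Y s) t ∨ Rec X t ∨ Rec (fun s => -X s) t)
    (hY : Y (t + 1) = Y t) (hX : X (t + 1) = X t + 1 ∨ X (t + 1) = X t - 1) :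
    Rec Y (t + 1) ∨ Rec (fun s => -Y s) (t + 1) ∨ Rec X (t + 1) ∨
      Rec (fun s => -X s) (t + 1) := by
  have extend : ∀ f : ℕ → ℤ, f t ≤ f (t + 1) → Rec f t → Rec f (t + 1) := by
    intro f hf hr j hj
    rcases Nat.le_or_eq_of_le_succ hj with hj | rfl
    · exact (hr j hj).trans hf
    · exact le_rfl
  by_cases hN : Rec Y t
  · exact .inl (extend _ hY.ge hN)
  by_cases hS : Rec (fun s => -Y s) t
  · exact .inr (.inl (extend (fun s => -Y s) (by simp [hY]) hS))
  rcases ih with ih | ih | ih | ih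
  · exact absurd ih hN
  · exact absurd ih hS
  · rcases hX with hX | hX
    · exact .inr (.inr (.inl (extend _ (by omega) ih)))
    · exact absurd hX (h.not_west ht hN hS ih)
  · rcases hX with hX | hX
    · exact absurd hX (h.not_east ht hN hS ih)
    · exact .inr (.inr (.inr (extend (fun s => -X s) (by omega) ih)))

/-- A prudent walker always stands on the boundary of the bounding box of its past. -/
theorem boundary (h : PrudentXY X Y n) {t : ℕ} (ht : t ≤ n) :
    Rec Y t ∨ Rec (fun s => -Y s) t ∨ Rec X t ∨ Rec (fun s => -X s) t := by
  induction t with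
  | zero => left; intro j hj; simp [Nat.le_zero.1 hj]
  | succ t ih =>
    have ih := ih (by omega)
    rcases h.step t ht with ⟨hY, hX⟩ | ⟨hX, hY⟩
    · exact h.boundary_of_horizontal ht ih hY hX
    · have := h.swap.boundary_of_horizontal ht (by tauto) hX hY
      tauto

end PrudentXY

/-! ## Windows that are not two-sided -/

/-- The number of distinct values of `f` up to time `t`. -/
def numValues (f : ℕ → ℤ) (t : ℕ) : ℕ := ((Finset.range (t + 1)).image f).card

theorem numValues_mono (f : ℕ → ℤ) : Monotone (numValues f) := fun _ _ h =>
  Finset.card_le_card (Finset.image_subset_image (Finset.range_mono (by omega)))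

theorem numValues_lt {f : ℕ → ℤ} {a b t : ℕ} (hat : a ≤ t) (htb : t ≤ b)
    (hnew : ∀ j ≤ a, f j ≠ f t) : numValues f a < numValues f b := by
  apply Finset.card_lt_card
  rw [Finset.ssubset_iff_of_subset (Finset.image_subset_image (Finset.range_mono (by omega)))]
  refine ⟨f t, Finset.mem_image_of_mem _ (by simp; omega), ?_⟩
  simp only [Finset.mem_image, Finset.mem_range, not_exists, not_and]
  exact fun j hj => hnew j (by omega)

/-- During the window of times `a, …, a + m` the path stays on the north or east side of its box. -/
def TwoSidedOn (X Y : ℕ → ℤ) (a m : ℕ) : Prop :=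
  ∀ t, a ≤ t → t ≤ a + m → Rec Y t ∨ Rec X t

/-- The window of times `a, …, a + m` is two-sided for one of the four orientations. -/
def SomeTwoSidedOn (X Y : ℕ → ℤ) (a m : ℕ) : Prop :=
  TwoSidedOn X Y a m ∨ TwoSidedOn (fun s => -X s) Y a m ∨
    TwoSidedOn X (fun s => -Y s) a m ∨ TwoSidedOn (fun s => -X s) (fun s => -Y s) a m

theorem SomeTwoSidedOn.swap {X Y : ℕ → ℤ} {a m : ℕ} (h : SomeTwoSidedOn X Y a m) :
    SomeTwoSidedOn Y X a m := by
  unfold SomeTwoSidedOn TwoSidedOn at *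
  simp only [or_comm (a := Rec X _), or_comm (a := Rec (fun s => -X s) _)]
  tauto

theorem SomeTwoSidedOn.of_negY {X Y : ℕ → ℤ} {a m : ℕ}
    (h : SomeTwoSidedOn X (fun s => -Y s) a m) : SomeTwoSidedOn X Y a m := by
  unfold SomeTwoSidedOn at *
  simp only [neg_neg] at h
  tauto

namespace PrudentXY

variable {X Y : ℕ → ℤ} {n a m : ℕ}

/-- Reaching two opposite sides of the box in a short time forces the box to be narrow. -/
theorem numValues_le (h : PrudentXY X Y n) (ha : a + m ≤ n) {t t' : ℕ} (hat : a ≤ t)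
    (htm : t ≤ a + m) (hat' : a ≤ t') (htm' : t' ≤ a + m) (hE : Rec X t)
    (hW : Rec (fun s => -X s) t') : numValues X a ≤ m + 1 := by
  have hsub : (Finset.range (a + 1)).image X ⊆ Finset.Icc (X t') (X t) := by
    intro x hx
    obtain ⟨j, hj, rfl⟩ := Finset.mem_image.1 hx
    rw [Finset.mem_range] at hj
    have h1 := hE j (by omega)
    have h2 := hW j (by omega)
    simp only [neg_le_neg_iff] at h2
    exact Finset.mem_Icc.2 ⟨h2, h1⟩
  have hcard := Finset.card_le_card hsub
  rw [Int.card_Icc] at hcard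
  have hdist : X t - X t' ≤ m := by
    rcases le_total t t' with hle | hle
    · obtain ⟨k, rfl⟩ := Nat.exists_eq_add_of_le hle
      have := h.abs_sub_le (i := t) k (by omega)
      rw [abs_le] at this
      omega
    · obtain ⟨k, rfl⟩ := Nat.exists_eq_add_of_le hle
      have := h.abs_sub_le (i := t') k (by omega)
      rw [abs_le] at this
      omega
  unfold numValues
  omega

theorem time_lt_mul (h : PrudentXY X Y n) {t : ℕ} (ht : t ≤ n) :
    t + 1 ≤ numValues X t * numValues Y t := by
  unfold numValues
  rw [← Finset.card_product]
  conv_lhs => rw [← Finset.card_range (t + 1)]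
  apply Finset.card_le_card_of_injOn (fun j => (X j, Y j))
  · intro j hj
    simp only [Finset.coe_product, Set.mem_prod, Finset.mem_coe]
    exact ⟨Finset.mem_image_of_mem _ hj, Finset.mem_image_of_mem _ hj⟩
  · intro i hi j hj hij
    simp only [Finset.coe_range, Set.mem_Iio, Prod.mk.injEq] at hi hj hij
    exact h.injective (by omega) (by omega) hij.1 hij.2

/-- One step of the backward induction along the west side, as long as no new column is visited. -/
theorem west_side_backward (h : PrudentXY X Y n) {t : ℕ} (ht : t < n)
    (hold : ∃ j ≤ t, X j = X (t + 1)) (hfull : Rec Y t → ∃ j < t, X j = X t)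
    (hS : ¬ Rec (fun s => -Y s) t) (hN : ¬ Rec Y (t + 1)) (hW : Rec (fun s => -X s) (t + 1)) :
    ¬ Rec Y t ∧ Rec (fun s => -X s) t := by
  have hXt : ∀ j ≤ t, X (t + 1) ≤ X j := fun j hj => by
    have := hW j (by omega)
    simpa using this
  obtain ⟨i, hi, hYi⟩ := not_rec.1 hN
  have hit : i ≤ t := by
    rcases Nat.le_or_eq_of_le_succ hi with hi | hi
    · exact hi
    · rw [Nat.succ_eq_add_one] at hi
      rw [hi] at hYi
      exact absurd hYi (lt_irrefl _)
  have hcase : X (t + 1) = X t ∧ ¬ Rec Y t := by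
    rcases h.step t ht with ⟨hY, hX | hX⟩ | ⟨hX, hY | hY⟩
    · have := hXt t le_rfl
      omega
    · have hNt : ¬ Rec Y t := not_rec.2 ⟨i, hit, by omega⟩
      rcases h.boundary ht.le with hb | hb | hb | hb
      · exact absurd hb hNt
      · exact absurd hb hS
      · exact absurd hX (h.not_west ht hNt hS hb)
      · obtain ⟨j, hj, hjX⟩ := hold
        have := hb j hj
        simp only at this
        omega
    · refine ⟨hX, fun hr => ?_⟩
      have := hr i hit
      omega
    · refine ⟨hX, fun hr => ?_⟩
      obtain ⟨j, hj, hjX⟩ := hfull hr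
      have h1 := h.south t ht hY j hj.le hjX
      have h2 := hr j hj.le
      have := h.injective (by omega) ht.le hjX (le_antisymm h2 h1)
      omega
  refine ⟨hcase.2, fun j hj => ?_⟩
  have := hXt j hj
  simp only
  omega

/-- Passing, without reaching the bottom row, from the part of the east side below the top row to
the part of the west side below the top row requires visiting a new column. -/
theorem exists_new_column (h : PrudentXY X Y n) {t₁ t₂ : ℕ} (ht₂ : t₂ ≤ n) (hat : a ≤ t₁)
    (h12 : t₁ ≤ t₂) (hS : ∀ t, a ≤ t → t ≤ t₂ → ¬ Rec (fun s => -Y s) t)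
    (hN₁ : ¬ Rec Y t₁) (hW₁ : ¬ Rec (fun s => -X s) t₁)
    (hN₂ : ¬ Rec Y t₂) (hW₂ : Rec (fun s => -X s) t₂) :
    ∃ t, a ≤ t ∧ t ≤ t₂ ∧ ∀ j ≤ a, X j ≠ X t := by
  by_contra! hold
  induction t₂, h12 using Nat.le_induction with
  | base => exact hW₁ hW₂
  | succ t h1t ih =>
    obtain ⟨j, hj, hjX⟩ := hold (t + 1) (by omega) le_rfl
    have hback := h.west_side_backward (by omega) ⟨j, by omega, hjX⟩ (fun hr => by
      obtain ⟨i, hi, hiX⟩ := hold t (by omega) (by omega)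
      refine ⟨i, ?_, hiX⟩
      rcases h1t.eq_or_lt with heq | hlt
      · exact absurd (heq ▸ hr) hN₁
      · omega) (hS t (by omega) (by omega)) hN₂ hW₂
    exact ih (by omega) (fun s hs hs' => hS s hs (by omega)) hback.1 hback.2
      (fun s hs hs' => hold s hs (by omega))

/-- A window with no visit to the bottom side is two-sided unless a new column is visited. -/
theorem widens_of_not_south (h : PrudentXY X Y n) (ha : a + m ≤ n)
    (hS : ∀ t, a ≤ t → t ≤ a + m → ¬ Rec (fun s => -Y s) t)
    (hbad : ¬ SomeTwoSidedOn X Y a m) : numValues X a < numValues X (a + m) := by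
  have h1 : ¬ TwoSidedOn X Y a m := fun h' => hbad (.inl h')
  have h2 : ¬ TwoSidedOn (fun s => -X s) Y a m := fun h' => hbad (.inr (.inl h'))
  unfold TwoSidedOn at h1 h2
  push Not at h1 h2
  obtain ⟨t₂, hat₂, htm₂, hN₂, hE₂⟩ := h1
  obtain ⟨t₁, hat₁, htm₁, hN₁, hW₁⟩ := h2
  have hW₂ : Rec (fun s => -X s) t₂ := by
    have := h.boundary (t := t₂) (by omega); have := hS t₂ hat₂ htm₂; tauto
  have hE₁ : Rec X t₁ := by
    have := h.boundary (t := t₁) (by omega); have := hS t₁ hat₁ htm₁; tauto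
  rcases le_total t₁ t₂ with hle | hle
  · obtain ⟨t, ht, ht', hnew⟩ := h.exists_new_column (a := a) (by omega) hat₁ hle
      (fun t ht ht' => hS t ht (by omega)) hN₁ hW₁ hN₂ hW₂
    exact numValues_lt ht (by omega) hnew
  · obtain ⟨t, ht, ht', hnew⟩ := h.negX.exists_new_column (a := a) (by omega) hat₂ hle
      (fun t ht ht' => hS t ht (by omega)) hN₂ (by simpa using hE₂) hN₁ (by simpa using hE₁)
    exact numValues_lt ht (by omega) (fun j hj => by simpa using hnew j hj)

theorem widens_of_tall (h : PrudentXY X Y n) (ha : a + m ≤ n) (hY : m + 1 < numValues Y a)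
    (hbad : ¬ SomeTwoSidedOn X Y a m) : numValues X a < numValues X (a + m) := by
  by_cases hS : ∃ t, a ≤ t ∧ t ≤ a + m ∧ Rec (fun s => -Y s) t
  · obtain ⟨t', hat', htm', hS⟩ := hS
    refine h.negY.widens_of_not_south ha (fun t hat htm hN => ?_)
      (fun h' => hbad h'.of_negY)
    simp only [neg_neg] at hN
    have := h.swap.numValues_le ha hat htm hat' htm' hN hS
    omega
  · push Not at hS
    exact h.widens_of_not_south ha hS hbad

/-- A window that is not two-sided occurs early, or widens a narrow box. -/
theorem bad_window (h : PrudentXY X Y n) (ha : a + m ≤ n) (hbad : ¬ SomeTwoSidedOn X Y a m) :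
    a < (m + 1) * (m + 1) ∨ (numValues X a ≤ m + 1 ∧ numValues X a < numValues X (a + m)) ∨
      (numValues Y a ≤ m + 1 ∧ numValues Y a < numValues Y (a + m)) := by
  have htime := h.time_lt_mul (t := a) (by omega)
  by_cases hX : numValues X a ≤ m + 1
  · by_cases hY : numValues Y a ≤ m + 1
    · left
      have := Nat.mul_le_mul hX hY
      omega
    · exact .inr (.inl ⟨hX, h.widens_of_tall ha (by omega) hbad⟩)
  · by_cases hY : numValues Y a ≤ m + 1
    · exact .inr (.inr ⟨hY, h.swap.widens_of_tall ha (by omega) (fun h' => hbad h'.swap)⟩)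
    · refine absurd ?_ hbad
      have hNS : ∀ t, a ≤ t → t ≤ a + m → ∀ t', a ≤ t' → t' ≤ a + m → Rec Y t →
          ¬ Rec (fun s => -Y s) t' := fun t h1 h2 t' h3 h4 h5 h6 =>
        hY (h.swap.numValues_le ha h1 h2 h3 h4 h5 h6)
      have hEW : ∀ t, a ≤ t → t ≤ a + m → ∀ t', a ≤ t' → t' ≤ a + m → Rec X t →
          ¬ Rec (fun s => -X s) t' := fun t h1 h2 t' h3 h4 h5 h6 =>
        hX (h.numValues_le ha h1 h2 h3 h4 h5 h6)
      have hb : ∀ t, a ≤ t → t ≤ a + m → _ := fun t h1 h2 => h.boundary (t := t) (by omega)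
      unfold SomeTwoSidedOn TwoSidedOn
      by_cases hN : ∃ t, a ≤ t ∧ t ≤ a + m ∧ Rec Y t <;>
        by_cases hE : ∃ t, a ≤ t ∧ t ≤ a + m ∧ Rec X t
      · obtain ⟨t, h1, h2, h3⟩ := hN
        obtain ⟨t', h1', h2', h3'⟩ := hE
        left
        intro s hs hs'
        have := hb s hs hs'
        have := hNS t h1 h2 s hs hs' h3
        have := hEW t' h1' h2' s hs hs' h3'
        tauto
      · obtain ⟨t, h1, h2, h3⟩ := hN
        right; left
        intro s hs hs'
        have := hb s hs hs'
        have := hNS t h1 h2 s hs hs' h3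
        have : ¬ Rec X s := fun h' => hE ⟨s, hs, hs', h'⟩
        tauto
      · obtain ⟨t', h1', h2', h3'⟩ := hE
        right; right; left
        intro s hs hs'
        have := hb s hs hs'
        have : ¬ Rec Y s := fun h' => hN ⟨s, hs, hs', h'⟩
        have := hEW t' h1' h2' s hs hs' h3'
        tauto
      · right; right; right
        intro s hs hs'
        have := hb s hs hs'
        have : ¬ Rec Y s := fun h' => hN ⟨s, hs, hs', h'⟩
        have : ¬ Rec X s := fun h' => hE ⟨s, hs, hs', h'⟩
        tauto

end PrudentXY

/-! ## Step lists and their coordinate functions -/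

/-- All entries of the list are unit steps of `ℤ²`. -/
def UnitSteps (l : List (ℤ × ℤ)) : Prop :=
  ∀ d ∈ l, d = (1, 0) ∨ d = (-1, 0) ∨ d = (0, 1) ∨ d = (0, -1)

/-- The list of unit steps `l` describes a prudent path, in terms of coordinate functions. -/
def PrudentList (l : List (ℤ × ℤ)) : Prop :=
  PrudentXY (fun t => (pt l t).1) (fun t => (pt l t).2) l.length

theorem pt_succ {l : List (ℤ × ℤ)} {i : ℕ} (hi : i < l.length) :
    pt l (i + 1) = pt l i + l.getD i (0, 0) := by
  simp [pt, List.sum_take_succ _ _ hi, hi]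

theorem pt_append_left {l l' : List (ℤ × ℤ)} {i : ℕ} (hi : i ≤ l.length) :
    pt (l ++ l') i = pt l i := by
  simp [pt, List.take_append_of_le_length hi]

theorem pt_length (l : List (ℤ × ℤ)) : pt l l.length = l.sum := by simp [pt]

theorem pt_append_length (l l' : List (ℤ × ℤ)) : pt (l ++ l') l.length = l.sum := by
  rw [pt_append_left le_rfl, pt_length]

theorem getD_unit {l : List (ℤ × ℤ)} (hl : UnitSteps l) {i : ℕ} (hi : i < l.length) :
    l.getD i (0, 0) = (1, 0) ∨ l.getD i (0, 0) = (-1, 0) ∨ l.getD i (0, 0) = (0, 1) ∨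
      l.getD i (0, 0) = (0, -1) := by
  rw [List.getD_eq_getElem _ _ hi]
  exact hl _ (List.getElem_mem hi)

theorem isPrudent_iff {l : List (ℤ × ℤ)} (hl : UnitSteps l) : IsPrudent l ↔ PrudentList l := by
  constructor
  · intro h
    have key : ∀ i < l.length, ∀ j ≤ i, ∀ k : ℕ, 1 ≤ k →
        ¬ ((pt l j).1 = (pt l i).1 + k * (l.getD i (0, 0)).1 ∧
          (pt l j).2 = (pt l i).2 + k * (l.getD i (0, 0)).2) := by
      rintro i hi j hj k hk ⟨h1, h2⟩
      exact h i hi k hk j hj (by ext <;> simp [h1, h2])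
    refine ⟨fun i hi => ?_, fun i hi hs j hj hy => ?_, fun i hi hs j hj hy => ?_,
      fun i hi hs j hj hy => ?_, fun i hi hs j hj hy => ?_⟩
    · have hp := pt_succ hi
      rcases getD_unit hl hi with hd | hd | hd | hd <;> rw [hd] at hp <;>
        simp [hp, sub_eq_add_neg]
    all_goals
      by_contra hlt
      have hp := pt_succ hi
      have key := key i hi j hj
      have k1 := key ((pt l j).1 - (pt l i).1).toNat
      have k2 := key ((pt l i).1 - (pt l j).1).toNat
      have k3 := key ((pt l j).2 - (pt l i).2).toNat
      have k4 := key ((pt l i).2 - (pt l j).2).toNat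
      rcases getD_unit hl hi with hd | hd | hd | hd <;> rw [hd] at hp k1 k2 k3 k4 <;>
        simp only [hp, Prod.fst_add, Prod.snd_add] at hs hy hlt k1 k2 k3 k4 <;> omega
  · intro h i hi k hk j hj heq
    have h1 := congrArg Prod.fst heq
    have h2 := congrArg Prod.snd heq
    have hs := pt_succ hi
    rcases getD_unit hl hi with hd | hd | hd | hd <;> rw [hd] at h1 h2 hs <;> simp at h1 h2
    · have := h.east i hi (by simp [hs]) j hj (by simp [h2])
      omega
    · have := h.west i hi (by simp [hs, sub_eq_add_neg]) j hj (by simp [h2])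
      omega
    · have := h.north i hi (by simp [hs]) j hj (by simp [h1])
      omega
    · have := h.south i hi (by simp [hs, sub_eq_add_neg]) j hj (by simp [h1])
      omega

theorem PrudentList.of_append {l l' : List (ℤ × ℤ)} (h : PrudentList (l ++ l')) : PrudentList l :=
  PrudentXY.window (a := 0) (c := 0) (d := 0) h (by simp)
    (fun t ht => by simp [pt_append_left ht]) (fun t ht => by simp [pt_append_left ht])

theorem sum_map_swap (l : List (ℤ × ℤ)) : (l.map Prod.swap).sum = l.sum.swap := by
  induction l with
  | nil => rfl
  | cons d l ih => simp [ih]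

theorem pt_map_swap (l : List (ℤ × ℤ)) (t : ℕ) : pt (l.map Prod.swap) t = (pt l t).swap := by
  rw [pt, ← List.map_take, sum_map_swap, pt]

theorem PrudentList.map_swap {l : List (ℤ × ℤ)} (h : PrudentList l) :
    PrudentList (l.map Prod.swap) := by
  have := PrudentXY.swap h
  unfold PrudentList
  simpa [pt_map_swap] using this

/-- Immediate reversals are not prudent. -/
theorem PrudentList.not_reverse {l : List (ℤ × ℤ)} {d : ℤ × ℤ} :
    ¬ PrudentList (l ++ [d] ++ [-d]) := by
  intro h
  have h1 : pt (l ++ [d] ++ [-d]) l.length = l.sum := by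
    rw [List.append_assoc, pt_append_length]
  have h2 : pt (l ++ [d] ++ [-d]) (l.length + 2) = l.sum := by
    have := pt_length (l ++ [d] ++ [-d])
    simpa using this
  have := PrudentXY.injective h (i := l.length) (j := l.length + 2) (by simp) (by simp)
    (by simp only [h1, h2]) (by simp only [h1, h2])
  omega

/-! ## Two-sided lists have a block decomposition -/

theorem weSteps_append {as bs : List ℤ} (ha : as ≠ []) (hb : bs ≠ []) :
    weSteps (as ++ bs) = weSteps as ++ (1, 0) :: weSteps bs := by
  induction as with
  | nil => exact absurd rfl ha
  | cons x as ih =>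
    cases as with
    | nil =>
      cases bs with
      | nil => exact absurd rfl hb
      | cons y bs => simp [weSteps, List.intercalate]
    | cons z as =>
      have := ih (by simp)
      simp only [weSteps, List.intercalate, List.cons_append, List.map_cons,
        List.intersperse_cons_cons, List.flatten_cons] at this ⊢
      rw [this]
      simp

theorem weSteps_singleton (ℓ : ℤ) : weSteps [ℓ] = vrun ℓ := by
  simp [weSteps, List.intercalate]

theorem vrun_add_one {ℓ : ℤ} (h : 0 ≤ ℓ) : vrun (ℓ + 1) = vrun ℓ ++ [(0, 1)] := by
  have h1 : (ℓ + 1).natAbs = ℓ.natAbs + 1 := by omega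
  simp [vrun, h1, h, (by omega : 0 ≤ ℓ + 1), List.replicate_succ']

theorem vrun_sub_one {ℓ : ℤ} (h : ℓ ≤ 0) : vrun (ℓ - 1) = vrun ℓ ++ [(0, -1)] := by
  have h1 : (ℓ - 1).natAbs = ℓ.natAbs + 1 := by omega
  rcases h.eq_or_lt with rfl | h
  · simp [vrun]
  · rw [vrun, vrun, h1, if_neg (by omega), if_neg (by omega), List.replicate_succ']

theorem weSteps_concat_of_vrun {ℓs : List ℤ} {ℓ ℓ' : ℤ} {d : ℤ × ℤ}
    (h : vrun ℓ' = vrun ℓ ++ [d]) : weSteps (ℓs ++ [ℓ']) = weSteps (ℓs ++ [ℓ]) ++ [d] := by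
  by_cases hs : ℓs = []
  · simp [hs, weSteps_singleton, h]
  · simp [weSteps_append hs, weSteps_singleton, h]

theorem sum_vrun (ℓ : ℤ) : (vrun ℓ).sum = (0, ℓ) := by
  unfold vrun
  rw [List.sum_replicate]
  split_ifs <;> ext <;> simp only [Prod.smul_mk, nsmul_eq_mul] <;> omega

theorem sum_weSteps {ℓs : List ℤ} (h : ℓs ≠ []) : (weSteps ℓs).sum = ((ℓs.length : ℤ) - 1, ℓs.sum) := by
  induction ℓs with
  | nil => exact absurd rfl h
  | cons ℓ ℓs ih =>
    by_cases hs : ℓs = []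
    · simp [hs, weSteps_singleton, sum_vrun]
    · rw [← List.singleton_append, weSteps_append (by simp) hs, List.sum_append, List.sum_cons,
        ih hs, weSteps_singleton, sum_vrun]
      simp

theorem vrun_map_swap (ℓ : ℤ) : (vrun ℓ).map Prod.swap = hrun ℓ := by
  unfold vrun hrun
  split_ifs <;> simp

theorem weSteps_map_swap (ℓs : List ℤ) : (weSteps ℓs).map Prod.swap = snSteps ℓs := by
  induction ℓs with
  | nil => rfl
  | cons ℓ ℓs ih =>
    cases ℓs with
    | nil => simp [weSteps, snSteps, List.intercalate, vrun_map_swap]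
    | cons ℓ' ℓs =>
      simp only [weSteps, snSteps, List.intercalate, List.map_cons, List.intersperse_cons_cons,
        List.flatten_cons, List.map_append] at ih ⊢
      rw [ih, vrun_map_swap]
      simp

theorem blockSteps_not (b : Bool) (ℓs : List ℤ) :
    blockSteps (!b) ℓs = (blockSteps b ℓs).map Prod.swap := by
  cases b
  · simp [blockSteps, ← weSteps_map_swap]
  · simp [blockSteps, ← weSteps_map_swap]

theorem neSteps_not (b : Bool) (bs : List (List ℤ)) :
    neSteps (!b) bs = (neSteps b bs).map Prod.swap := by
  induction bs generalizing b with
  | nil => rfl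
  | cons ℓs bs ih => simp only [neSteps, List.map_append, ih, blockSteps_not]

theorem neSteps_append (b : Bool) (bs cs : List (List ℤ)) :
    neSteps b (bs ++ cs) = neSteps b bs ++ neSteps (not^[bs.length] b) cs := by
  induction bs generalizing b with
  | nil => rfl
  | cons ℓs bs ih => simp [neSteps, ih]

/-- The list of steps admits a decomposition into alternating oriented blocks. -/
def HasNEData (l : List (ℤ × ℤ)) : Prop := ∃ b bs, IsNEData bs ∧ neSteps b bs = l

theorem HasNEData.map_swap {l : List (ℤ × ℤ)} (h : HasNEData l) :
    HasNEData (l.map Prod.swap) := by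
  obtain ⟨b, bs, hbs, rfl⟩ := h
  exact ⟨!b, bs, hbs, neSteps_not b bs⟩

theorem IsNEData.replace_last {bs : List (List ℤ)} {ℓs ℓs' : List ℤ} (h : IsNEData (bs ++ [ℓs]))
    (hne : ℓs' ≠ []) (hhead : bs ≠ [] → ℓs'.headI < 0) : IsNEData (bs ++ [ℓs']) := by
  obtain ⟨-, h1, h2, h3⟩ := h
  refine ⟨by simp, fun m hm => ?_, fun i hi => ?_, fun i hi hi' => ?_⟩
  · rcases List.mem_append.1 hm with hm | hm
    · exact h1 m (by simp [hm])
    · simpa [List.mem_singleton.1 hm] using hne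
  · simp only [List.length_append, List.length_singleton] at hi h2
    have := h2 i hi
    rwa [List.getD_append _ _ _ _ (by omega)] at this ⊢
  · simp only [List.length_append, List.length_singleton] at hi' h3
    rcases (Nat.lt_succ_iff.1 hi').lt_or_eq with hlt | heq
    · have := h3 i hi hi'
      rwa [List.getD_append _ _ _ _ hlt] at this ⊢
    · rw [List.getD_append_right _ _ _ _ (by omega)]
      simpa [heq] using hhead (by rintro rfl; simp at heq; omega)

theorem IsNEData.push {bs : List (List ℤ)} {ℓs ℓs' : List ℤ} (h : IsNEData (bs ++ [ℓs]))
    (hexit : upperExit ℓs) (hne : ℓs' ≠ []) (hhead : ℓs'.headI < 0) :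
    IsNEData (bs ++ [ℓs] ++ [ℓs']) := by
  obtain ⟨-, h1, h2, h3⟩ := h
  refine ⟨by simp, fun m hm => ?_, fun i hi => ?_, fun i hi hi' => ?_⟩
  · rcases List.mem_append.1 hm with hm | hm
    · exact h1 m hm
    · simpa [List.mem_singleton.1 hm] using hne
  · have hlen : (bs ++ [ℓs] ++ [ℓs']).length = bs.length + 2 := by simp
    rw [List.getD_append _ _ _ _ (by simp; omega)]
    rcases (by omega : i < bs.length ∨ i = bs.length) with hlt | rfl
    · exact h2 i (by simp; omega)
    · rw [List.getD_append_right _ _ _ _ le_rfl]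
      simpa using hexit
  · have hlen : (bs ++ [ℓs] ++ [ℓs']).length = bs.length + 2 := by simp
    rcases (by omega : i < bs.length + 1 ∨ i = bs.length + 1) with hlt | rfl
    · rw [List.getD_append _ _ _ _ (by simp; omega)]
      exact h3 i hi (by simp; omega)
    · rw [List.getD_append_right _ _ _ _ (by simp)]
      simpa using hhead

/-- The end of each stretch of the last block is a site of the path. -/
theorem exists_pt_stretch_end (pre : List (ℤ × ℤ)) (ℓs : List ℤ) (l' : List (ℤ × ℤ)) {i : ℕ}
    (hi : i < ℓs.length) : ∃ j ≤ (pre ++ weSteps ℓs).length,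
      (pt (pre ++ weSteps ℓs ++ l') j).2 = pre.sum.2 + (ℓs.take i).sum ∧
      (pt (pre ++ weSteps ℓs ++ l') j).1 = pre.sum.1 + ((i - 1 : ℕ) : ℤ) := by
  rcases Nat.eq_zero_or_pos i with rfl | hpos
  · exact ⟨pre.length, by simp, by rw [List.append_assoc, pt_append_length]; simp⟩
  · have hsplit : weSteps ℓs = weSteps (ℓs.take i) ++ (1, 0) :: weSteps (ℓs.drop i) := by
      conv_lhs => rw [← List.take_append_drop i ℓs]
      exact weSteps_append (by rw [← List.length_pos_iff]; simp; omega)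
        (by rw [← List.length_pos_iff]; simp; omega)
    refine ⟨(pre ++ weSteps (ℓs.take i)).length, by rw [hsplit]; simp, ?_⟩
    rw [hsplit, List.append_assoc pre, List.append_assoc, ← List.append_assoc pre,
      pt_append_length, List.sum_append,
      sum_weSteps (by rw [← List.length_pos_iff]; simp; omega)]
    simp
    omega

/-- A west step taken from the top row after a west-east block requires the upper exit condition. -/
theorem upperExit_of_west {pre : List (ℤ × ℤ)} {ℓs : List ℤ} (hne : ℓs ≠ [])
    (hsingle : ℓs ≠ [0]) (hpr : PrudentList (pre ++ weSteps ℓs ++ [(-1, 0)]))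
    (htop : Rec (fun t => (pt (pre ++ weSteps ℓs ++ [(-1, 0)]) t).2)
      (pre ++ weSteps ℓs).length) : upperExit ℓs := by
  intro i hi
  set l := pre ++ weSteps ℓs with hl
  obtain ⟨j, hj, hj2, hj1⟩ := exists_pt_stretch_end pre ℓs [(-1, 0)] hi
  rw [← hl] at hj hj2 hj1
  have hend : pt (l ++ [(-1, 0)]) l.length = pre.sum + ((ℓs.length : ℤ) - 1, ℓs.sum) := by
    rw [pt_append_length, hl, List.sum_append, sum_weSteps hne]
  have hlast : pt (l ++ [(-1, 0)]) (l.length + 1) = pre.sum + ((ℓs.length : ℤ) - 1, ℓs.sum) + (-1, 0) := by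
    rw [← hend, pt_succ (by simp)]
    simp
  have h1 := htop j hj
  simp only [hj2, hend, Prod.snd_add] at h1
  by_contra hnot
  have hsum : (ℓs.take i).sum = ℓs.sum := by omega
  have h2 := hpr.west l.length (by simp) (by simp only [hlast, hend, Prod.fst_add]; omega) j hj
    (by simp only [hend, hj2, Prod.snd_add, hsum])
  simp only [hend, hj1, Prod.fst_add] at h2
  have hlen : ℓs.length = 1 ∧ i = 0 := by omega
  obtain ⟨x, rfl⟩ := List.length_eq_one_iff.1 hlen.1
  rw [hlen.2] at hsum
  simp at hsum
  exact hsingle (by rw [← hsum])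

theorem hasNEData_concat_of_we {b : Bool} {bs : List (List ℤ)} {ℓs : List ℤ} {ℓ : ℤ} {d : ℤ × ℤ}
    (hdata : IsNEData (bs ++ [ℓs ++ [ℓ]])) (hb : not^[bs.length] b = true)
    (hd : d = (1, 0) ∨ d = (-1, 0) ∨ d = (0, 1) ∨ d = (0, -1))
    (hpr : PrudentList (neSteps b (bs ++ [ℓs ++ [ℓ]]) ++ [d]))
    (htwo : Rec (fun t => (pt (neSteps b (bs ++ [ℓs ++ [ℓ]]) ++ [d]) t).2)
        ((neSteps b (bs ++ [ℓs ++ [ℓ]])).length + 1) ∨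
      Rec (fun t => (pt (neSteps b (bs ++ [ℓs ++ [ℓ]]) ++ [d]) t).1)
        ((neSteps b (bs ++ [ℓs ++ [ℓ]])).length + 1)) :
    HasNEData (neSteps b (bs ++ [ℓs ++ [ℓ]]) ++ [d]) := by
  have hform : ∀ m, neSteps b (bs ++ [m]) = neSteps b bs ++ weSteps m := fun m => by
    rw [neSteps_append, hb]; simp [neSteps, blockSteps]
  have hhead : bs ≠ [] → (ℓs ++ [ℓ]).headI < 0 := fun hne => by
    have := hdata.2.2.2 bs.length (List.length_pos_iff.2 hne) (by simp)
    rwa [List.getD_append_right _ _ _ _ le_rfl, Nat.sub_self, List.getD_cons_zero] at this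
  rw [hform] at *
  rcases hd with rfl | rfl | rfl | rfl
  · refine ⟨b, bs ++ [ℓs ++ [ℓ] ++ [0]], hdata.replace_last (by simp) (fun hne => ?_), ?_⟩
    · have := hhead hne
      cases ℓs <;> simpa using this
    · rw [hform, weSteps_append (by simp) (by simp), weSteps_singleton]
      simp [vrun]
  · by_cases hzero : ℓs ++ [ℓ] = [0]
    · have hbs : bs = [] := by
        by_contra hne
        have := hhead hne
        rw [hzero] at this
        simp at this
      subst hbs
      refine ⟨false, [[-1]], ?_, ?_⟩
      · exact IsNEData.replace_last (bs := []) hdata (by simp) (by simp)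
      · rw [hzero, weSteps_singleton]
        simp [neSteps, blockSteps, snSteps, List.intercalate, hrun, vrun]
    · set l := neSteps b bs ++ weSteps (ℓs ++ [ℓ]) with hl
      have hlast : pt (l ++ [(-1, 0)]) (l.length + 1) = pt (l ++ [(-1, 0)]) l.length + (-1, 0) := by
        rw [pt_succ (by simp)]; simp
      have htop : Rec (fun t => (pt (l ++ [(-1, 0)]) t).2) l.length := by
        rcases htwo with h | h
        · intro j hj
          have := h j (by omega)
          simpa [hlast] using this
        · have := h l.length (by omega)
          simp [hlast] at this
      refine ⟨b, bs ++ [ℓs ++ [ℓ]] ++ [[-1]],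
        hdata.push (upperExit_of_west (by simp) hzero hpr htop) (by simp) (by simp), ?_⟩
      rw [neSteps_append, hform, List.length_append, List.length_singleton,
        Function.iterate_succ_apply', hb]
      simp [neSteps, blockSteps, snSteps, List.intercalate, hrun, hl]
  · have hℓ : 0 ≤ ℓ := by
      by_contra hneg
      have hv := vrun_sub_one (ℓ := ℓ + 1) (by omega)
      rw [add_sub_cancel_right] at hv
      rw [weSteps_concat_of_vrun hv, ← List.append_assoc] at hpr
      exact PrudentList.not_reverse (l := neSteps b bs ++ weSteps (ℓs ++ [ℓ + 1]))
        (d := (0, -1)) (by simpa using hpr)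
    refine ⟨b, bs ++ [ℓs ++ [ℓ + 1]], hdata.replace_last (by simp) (fun hne => ?_), ?_⟩
    · have := hhead hne
      cases ℓs
      · simp at this; omega
      · simpa using this
    · rw [hform, weSteps_concat_of_vrun (vrun_add_one hℓ), List.append_assoc]
  · have hℓ : ℓ ≤ 0 := by
      by_contra hpos
      have hv := vrun_add_one (ℓ := ℓ - 1) (by omega)
      rw [sub_add_cancel] at hv
      rw [weSteps_concat_of_vrun hv, ← List.append_assoc] at hpr
      exact PrudentList.not_reverse (l := neSteps b bs ++ weSteps (ℓs ++ [ℓ - 1]))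
        (d := (0, 1)) (by simpa using hpr)
    refine ⟨b, bs ++ [ℓs ++ [ℓ - 1]], hdata.replace_last (by simp) (fun hne => ?_), ?_⟩
    · have := hhead hne
      cases ℓs
      · simp at this ⊢; omega
      · simpa using this
    · rw [hform, weSteps_concat_of_vrun (vrun_sub_one hℓ), List.append_assoc]

/-- A prudent path staying on the north or east side of its box is a concatenation of alternating
oriented blocks. -/
theorem hasNEData_of_twoSided {l : List (ℤ × ℤ)} (hl : UnitSteps l) (hpr : PrudentList l)
    (htwo : ∀ t ≤ l.length, Rec (fun t => (pt l t).2) t ∨ Rec (fun t => (pt l t).1) t) :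
    HasNEData l := by
  induction l using List.reverseRecOn with
  | nil =>
    exact ⟨true, [[0]], ⟨by simp, by simp, by simp, by simp; omega⟩,
      by simp [neSteps, blockSteps, weSteps_singleton, vrun]⟩
  | append_singleton l d ih =>
    obtain ⟨b, bs₀, hdata, rfl⟩ := ih (fun e he => hl e (by simp [he])) hpr.of_append (fun t ht => by
      have := htwo t (by simp; omega)
      have hpt : ∀ j ≤ t, pt (l ++ [d]) j = pt l j := fun j hj => pt_append_left (by omega)
      unfold Rec at this ⊢
      simp only at this ⊢
      rw [hpt t le_rfl] at this
      exact this.imp (fun h j hj => by have := h j hj; rwa [hpt j hj] at this)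
        (fun h j hj => by have := h j hj; rwa [hpt j hj] at this))
    obtain ⟨bs, m, rfl⟩ : ∃ bs m, bs₀ = bs ++ [m] :=
      ⟨_, _, (List.dropLast_append_getLast hdata.1).symm⟩
    have hm : m ≠ [] := hdata.2.1 m (by simp)
    obtain ⟨ℓs, ℓ, rfl⟩ : ∃ ℓs ℓ, m = ℓs ++ [ℓ] :=
      ⟨_, _, (List.dropLast_append_getLast hm).symm⟩
    have hd := hl d (by simp)
    have hlast := htwo ((neSteps b (bs ++ [ℓs ++ [ℓ]])).length + 1) (by simp)
    cases hb : not^[bs.length] b with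
    | true => exact hasNEData_concat_of_we hdata hb hd hpr hlast
    | false =>
      have hb' : not^[bs.length] (!b) = true := by
        rw [← Function.iterate_succ_apply, Function.iterate_succ_apply', hb]; rfl
      have heq : neSteps (!b) (bs ++ [ℓs ++ [ℓ]]) ++ [d.swap] =
          (neSteps b (bs ++ [ℓs ++ [ℓ]]) ++ [d]).map Prod.swap := by
        rw [neSteps_not]; simp
      have hlen : (neSteps (!b) (bs ++ [ℓs ++ [ℓ]])).length =
          (neSteps b (bs ++ [ℓs ++ [ℓ]])).length := by
        rw [neSteps_not]; simp
      have := hasNEData_concat_of_we (b := !b) (d := d.swap) hdata hb'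
        (by rcases hd with rfl | rfl | rfl | rfl <;> simp) (by rw [heq]; exact hpr.map_swap)
        (by
          rw [heq, hlen]
          simp only [pt_map_swap, Prod.fst_swap, Prod.snd_swap]
          exact hlast.symm)
      rw [heq] at this
      simpa using this.map_swap

/-! ## Windows and reflections of direction sequences -/

theorem length_stepsOf {L : ℕ} (s : Fin L → Fin 4) : (stepsOf s).length = L := by
  simp [stepsOf]

theorem unitSteps_stepsOf {L : ℕ} (s : Fin L → Fin 4) : UnitSteps (stepsOf s) := by
  intro d hd
  obtain ⟨i, -, rfl⟩ := List.mem_map.1 hd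
  fin_cases i <;> simp [dirs]

theorem pt_stepsOf_succ {L : ℕ} (s : Fin L → Fin 4) (t : Fin L) :
    pt (stepsOf s) (t + 1) = pt (stepsOf s) t + dirs (s t) := by
  rw [pt_succ (by rw [length_stepsOf]; exact t.2), List.getD_eq_getElem _ _ (by simp [stepsOf])]
  simp [stepsOf]

section Window

variable {X Y : ℕ → ℤ} {a n M : ℕ} {s : Fin M → Fin 4}

theorem pt_stepsOf_of_increments
    (hs : ∀ t : Fin M, dirs (s t) = (X (a + t + 1) - X (a + t), Y (a + t + 1) - Y (a + t)))
    {t : ℕ} (ht : t ≤ M) : pt (stepsOf s) t = (X (a + t) - X a, Y (a + t) - Y a) := by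
  induction t with
  | zero => ext <;> simp [pt]
  | succ t ih =>
    rw [pt_stepsOf_succ s ⟨t, ht⟩, ih (by omega), hs ⟨t, ht⟩]
    ext <;> simp [add_assoc]

theorem PrudentXY.prudentList_window (h : PrudentXY X Y n) (ha : a + M ≤ n)
    (hs : ∀ t : Fin M, dirs (s t) = (X (a + t + 1) - X (a + t), Y (a + t + 1) - Y (a + t))) :
    PrudentList (stepsOf s) := by
  unfold PrudentList
  rw [length_stepsOf]
  exact h.window ha (fun t ht => by rw [pt_stepsOf_of_increments hs ht])
    (fun t ht => by rw [pt_stepsOf_of_increments hs ht])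

theorem PrudentXY.isNEPath_window (h : PrudentXY X Y n) (ha : a + M ≤ n)
    (h2 : TwoSidedOn X Y a M)
    (hs : ∀ t : Fin M, dirs (s t) = (X (a + t + 1) - X (a + t), Y (a + t + 1) - Y (a + t))) :
    IsNEPath (stepsOf s) := by
  have hpr := h.prudentList_window ha hs
  refine ⟨(isPrudent_iff (unitSteps_stepsOf s)).2 hpr,
    hasNEData_of_twoSided (unitSteps_stepsOf s) hpr fun t ht => ?_⟩
  rw [length_stepsOf] at ht
  refine (h2 (a + t) (by omega) (by omega)).imp (fun hr j hj => ?_) (fun hr j hj => ?_)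
  all_goals
    have := hr (a + j) (by omega)
    simp only [pt_stepsOf_of_increments hs ht, pt_stepsOf_of_increments hs (hj.trans ht)]
    omega

end Window

/-- The increments of the coordinates of a path are its steps. -/
theorem dirs_eq_increments {L : ℕ} (s : Fin L → Fin 4) (t : Fin L) : dirs (s t) =
    ((pt (stepsOf s) (t + 1)).1 - (pt (stepsOf s) t).1,
      (pt (stepsOf s) (t + 1)).2 - (pt (stepsOf s) t).2) := by
  rw [pt_stepsOf_succ]
  ext <;> simp

theorem mem_psawFinset {L : ℕ} {s : Fin L → Fin 4} :
    s ∈ psawFinset L ↔ PrudentList (stepsOf s) := by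
  simp [psawFinset, isPrudent_iff (unitSteps_stepsOf s)]

theorem mem_neFinset {L : ℕ} {s : Fin L → Fin 4} :
    s ∈ neFinset L ↔ IsNEPath (stepsOf s) := by
  simp [neFinset]

/-- The coordinates of a prudent direction sequence. -/
theorem prudentXY_of_mem {L : ℕ} {s : Fin L → Fin 4} (hs : s ∈ psawFinset L) :
    PrudentXY (fun t => (pt (stepsOf s) t).1) (fun t => (pt (stepsOf s) t).2) L := by
  have := mem_psawFinset.1 hs
  rwa [PrudentList, length_stepsOf] at this

theorem window_mem_psawFinset {L M a : ℕ} {s : Fin L → Fin 4} {s' : Fin M → Fin 4}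
    (hs : s ∈ psawFinset L) (ha : a + M ≤ L)
    (hs' : ∀ t : Fin M, s' t = s ⟨a + t, by omega⟩) : s' ∈ psawFinset M :=
  mem_psawFinset.2 ((prudentXY_of_mem hs).prudentList_window ha fun t => by
    rw [hs' t, dirs_eq_increments])

/-- The reflections of the four directions with respect to the coordinate axes. -/
def reflection : Fin 4 → Fin 4 → Fin 4 :=
  ![![0, 1, 2, 3], ![1, 0, 2, 3], ![0, 1, 3, 2], ![1, 0, 3, 2]]

theorem reflection_injective (o : Fin 4) : Function.Injective (reflection o) := by
  revert o; decide

theorem dirs_reflection (d : Fin 4) :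
    dirs (reflection 0 d) = dirs d ∧ dirs (reflection 1 d) = (-(dirs d).1, (dirs d).2) ∧
    dirs (reflection 2 d) = ((dirs d).1, -(dirs d).2) ∧
    dirs (reflection 3 d) = (-(dirs d).1, -(dirs d).2) := by
  revert d; decide

open scoped Classical in
/-- The direction sequences that are NE-prudent up to a reflection. -/
noncomputable def reflectedNE (M : ℕ) : Finset (Fin M → Fin 4) :=
  Finset.univ.biUnion fun o : Fin 4 =>
    Finset.univ.filter fun s => reflection o ∘ s ∈ neFinset M

theorem card_reflectedNE_le (M : ℕ) : (reflectedNE M).card ≤ 4 * (neFinset M).card := by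
  classical
  refine (Finset.card_biUnion_le_card_mul _ _ (neFinset M).card fun o _ => ?_).trans (by simp)
  refine Finset.card_le_card_of_injOn (fun s => reflection o ∘ s) (fun s hs => ?_) ?_
  · simpa using hs
  · exact (reflection_injective o).comp_left.injOn

theorem neFinset_subset_reflectedNE (M : ℕ) : neFinset M ⊆ reflectedNE M := by
  intro s hs
  have : reflection 0 ∘ s = s := by
    ext t
    have : ∀ d, reflection 0 d = d := by decide
    simp [this]
  exact Finset.mem_biUnion.2 ⟨0, Finset.mem_univ _, by simpa [this] using hs⟩

theorem window_mem_reflectedNE {L M a : ℕ} {s : Fin L → Fin 4} {s' : Fin M → Fin 4}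
    (hs : s ∈ psawFinset L) (ha : a + M ≤ L)
    (h2 : SomeTwoSidedOn (fun t => (pt (stepsOf s) t).1) (fun t => (pt (stepsOf s) t).2) a M)
    (hs' : ∀ t : Fin M, s' t = s ⟨a + t, by omega⟩) : s' ∈ reflectedNE M := by
  have hpr := prudentXY_of_mem hs
  have hd : ∀ t : Fin M, dirs (s' t) =
      ((pt (stepsOf s) (a + t + 1)).1 - (pt (stepsOf s) (a + t)).1,
        (pt (stepsOf s) (a + t + 1)).2 - (pt (stepsOf s) (a + t)).2) := fun t => by
    rw [hs' t]; exact dirs_eq_increments s ⟨a + t, by omega⟩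
  suffices ∃ o, IsNEPath (stepsOf (reflection o ∘ s')) by
    obtain ⟨o, ho⟩ := this
    exact Finset.mem_biUnion.2 ⟨o, Finset.mem_univ _, by
      simpa using mem_neFinset.2 ho⟩
  rcases h2 with h2 | h2 | h2 | h2
  · refine ⟨0, hpr.isNEPath_window ha h2 fun t => ?_⟩
    rw [Function.comp_apply, (dirs_reflection _).1, hd t]
  · refine ⟨1, hpr.negX.isNEPath_window ha h2 fun t => ?_⟩
    rw [Function.comp_apply, (dirs_reflection _).2.1, hd t]
    ext <;> simp only; ring
  · refine ⟨2, hpr.negY.isNEPath_window ha h2 fun t => ?_⟩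
    rw [Function.comp_apply, (dirs_reflection _).2.2.1, hd t]
    ext <;> simp only; ring
  · refine ⟨3, hpr.negX.negY.isNEPath_window ha h2 fun t => ?_⟩
    rw [Function.comp_apply, (dirs_reflection _).2.2.2, hd t]
    ext <;> simp only <;> ring

/-! ## Counting -/

/-- A function on time steps that grows strictly on marked windows and is at most `K` at their
start marks at most `K + 1` windows. -/
theorem card_growth_windows_le {f : ℕ → ℕ} (hf : Monotone f) (q M K : ℕ) :
    (Finset.univ.filter fun i : Fin q => f (M * i) ≤ K ∧ f (M * i) < f (M * i + M)).card ≤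
      K + 1 := by
  have hinj : ∀ i j : Fin q, f (M * i) < f (M * i + M) → f (M * i) = f (M * j) → ¬ i < j := by
    intro i j hi hij hlt
    have : M * i + M ≤ M * j := by
      rw [← Nat.mul_succ]; exact Nat.mul_le_mul_left _ hlt
    have := hf this
    omega
  rw [← Finset.card_range (K + 1)]
  refine Finset.card_le_card_of_injOn (fun i : Fin q => f (M * i)) (fun i hi => ?_) ?_
  · have := (Finset.mem_filter.1 hi).2.1
    simp; omega
  · intro i hi j hj hij
    have h1 := hinj i j (Finset.mem_filter.1 hi).2.2 hij
    have h2 := hinj j i (Finset.mem_filter.1 hj).2.2 hij.symm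
    exact le_antisymm (not_lt.1 h2) (not_lt.1 h1)

/-- The windows of length `M` of a prudent path of length `q * M` are two-sided with a number of
exceptions bounded independently of `q`. -/
theorem card_bad_windows_le {q M : ℕ} (hM : 0 < M) {s : Fin (q * M) → Fin 4}
    (hs : s ∈ psawFinset (q * M)) :
    (Finset.univ.filter fun i : Fin q =>
      (fun k => s (finProdFinEquiv (i, k))) ∉ reflectedNE M).card ≤
      (M + 1) * (M + 1) + (M + 2) + (M + 2) := by
  set X : ℕ → ℤ := fun t => (pt (stepsOf s) t).1
  set Y : ℕ → ℤ := fun t => (pt (stepsOf s) t).2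
  have hsub : (Finset.univ.filter fun i : Fin q =>
      (fun k => s (finProdFinEquiv (i, k))) ∉ reflectedNE M) ⊆
      (Finset.univ.filter fun i : Fin q => (i : ℕ) < (M + 1) * (M + 1)) ∪
      (Finset.univ.filter fun i : Fin q =>
        numValues X (M * i) ≤ M + 1 ∧ numValues X (M * i) < numValues X (M * i + M)) ∪
      (Finset.univ.filter fun i : Fin q =>
        numValues Y (M * i) ≤ M + 1 ∧ numValues Y (M * i) < numValues Y (M * i + M)) := by
    intro i hi
    have ha : M * i + M ≤ q * M := by
      rw [← Nat.mul_succ, mul_comm q]; exact Nat.mul_le_mul_left _ i.2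
    have hbad : ¬ SomeTwoSidedOn X Y (M * i) M := fun h2 =>
      (Finset.mem_filter.1 hi).2 (window_mem_reflectedNE hs ha h2 fun t => by
        congr 1; ext; simp [add_comm])
    have hle : (i : ℕ) ≤ M * i := Nat.le_mul_of_pos_left _ hM
    simp only [Finset.mem_union, Finset.mem_filter, Finset.mem_univ, true_and]
    rcases (prudentXY_of_mem hs).bad_window ha hbad with h | h | h
    · exact .inl (.inl (by omega))
    · exact .inl (.inr h)
    · exact .inr h
  have hfirst : (Finset.univ.filter fun i : Fin q => (i : ℕ) < (M + 1) * (M + 1)).card ≤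
      (M + 1) * (M + 1) := by
    conv_rhs => rw [← Finset.card_range ((M + 1) * (M + 1))]
    exact Finset.card_le_card_of_injOn Fin.val (fun i hi => by simpa using hi)
      Fin.val_injective.injOn
  calc _ ≤ _ := Finset.card_le_card hsub
    _ ≤ _ := Finset.card_union_le _ _
    _ ≤ _ := Nat.add_le_add ((Finset.card_union_le _ _).trans (Nat.add_le_add hfirst
        (card_growth_windows_le (numValues_mono X) q M (M + 1))))
        (card_growth_windows_le (numValues_mono Y) q M (M + 1))

open scoped Classical in
/-- The number of functions taking at most `C` values outside `G`. -/
theorem card_few_outside_le {ι α : Type*} [Fintype ι] [Fintype α] {G : Finset α}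
    (hG : G.Nonempty) (C : ℕ) :
    (Finset.univ.filter fun f : ι → α => (Finset.univ.filter fun i => f i ∉ G).card ≤ C).card ≤
      2 ^ Fintype.card ι * (G.card ^ Fintype.card ι * Fintype.card α ^ C) := by
  have hpos : 0 < G.card := hG.card_pos
  have hpos' : 0 < Fintype.card α := Fintype.card_pos_iff.2 ⟨hG.choose⟩
  have hsub : (Finset.univ.filter fun f : ι → α =>
      (Finset.univ.filter fun i => f i ∉ G).card ≤ C) ⊆
      (Finset.univ.filter fun B : Finset ι => B.card ≤ C).biUnion fun B =>
        Fintype.piFinset fun i => if i ∈ B then Finset.univ else G := by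
    intro f hf
    refine Finset.mem_biUnion.2 ⟨Finset.univ.filter fun i => f i ∉ G, ?_, ?_⟩
    · simpa using hf
    · rw [Fintype.mem_piFinset]
      intro i
      by_cases hi : f i ∈ G <;> simp [hi]
  refine (Finset.card_le_card hsub).trans ((Finset.card_biUnion_le_card_mul _ _ _
    fun B hB => ?_).trans (Nat.mul_le_mul_right _ ((Finset.card_le_univ _).trans (by simp))))
  rw [Fintype.card_piFinset]
  simp only [apply_ite Finset.card, Finset.prod_ite, Finset.prod_const, Finset.card_univ]
  rw [mul_comm]
  refine Nat.mul_le_mul (Nat.pow_le_pow_right hpos (Finset.card_le_univ _))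
    (Nat.pow_le_pow_right hpos' ?_)
  simpa using hB

theorem neFinset_nonempty (M : ℕ) : (neFinset M).Nonempty := by
  refine ⟨fun _ => 2, ?_⟩
  have hpr : PrudentXY (fun _ => 0) (fun t => (t : ℤ)) M := by
    constructor <;> intro i hi <;> (simp; try omega)
  have : IsNEPath (stepsOf fun _ : Fin M => 2) :=
    hpr.isNEPath_window (a := 0) (by simp) (fun t _ _ => .inl fun j hj => by simpa using hj)
      fun t => by simp [dirs]
  exact mem_neFinset.2 this

theorem neFinset_subset_psawFinset (M : ℕ) : neFinset M ⊆ psawFinset M := by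
  intro s hs
  simp only [neFinset, psawFinset, Finset.mem_filter] at hs ⊢
  exact ⟨hs.1, hs.2.1⟩

theorem psawFinset_nonempty (M : ℕ) : (psawFinset M).Nonempty :=
  (neFinset_nonempty M).mono (neFinset_subset_psawFinset M)

theorem card_psawFinset_add_le (m n : ℕ) :
    (psawFinset (m + n)).card ≤ (psawFinset m).card * (psawFinset n).card := by
  rw [← Finset.card_product]
  refine Finset.card_le_card_of_injOn
    (fun s => (fun i => s (Fin.castAdd n i), fun i => s (Fin.natAdd m i))) (fun s hs => ?_) ?_
  · simp only [Finset.coe_product, Set.mem_prod, Finset.mem_coe]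
    exact ⟨window_mem_psawFinset (a := 0) hs (by omega) fun t => by
        congr 1; ext; simp, window_mem_psawFinset (a := m) hs le_rfl fun t => rfl⟩
  · intro s _ s' _ h
    rw [Prod.mk.injEq] at h
    rw [← Fin.append_castAdd_natAdd (f := s), ← Fin.append_castAdd_natAdd (f := s'), h.1, h.2]

theorem card_psawFinset_mul_le (q : ℕ) {M : ℕ} (hM : 0 < M) :
    (psawFinset (q * M)).card ≤ 2 ^ q * ((4 * (neFinset M).card) ^ q *
      (4 ^ M) ^ ((M + 1) * (M + 1) + (M + 2) + (M + 2))) := by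
  classical
  have hcount := card_few_outside_le (ι := Fin q)
    ((neFinset_nonempty M).mono (neFinset_subset_reflectedNE M))
    ((M + 1) * (M + 1) + (M + 2) + (M + 2))
  simp only [Fintype.card_fin, Fintype.card_fun] at hcount
  refine (Finset.card_le_card_of_injOn (fun s i k => s (finProdFinEquiv (i, k)))
    (fun s hs => ?_) ?_).trans (hcount.trans ?_)
  · simpa using card_bad_windows_le hM hs
  · intro s _ s' _ h
    ext j
    obtain ⟨⟨i, k⟩, rfl⟩ := finProdFinEquiv.surjective j
    exact congrArg Fin.val (congrFun (congrFun h i) k)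
  · gcongr
    exact card_reflectedNE_le M

/-! ## Growth rates -/

theorem subadditive_log_card_psawFinset :
    Subadditive fun L => Real.log ((psawFinset L).card : ℝ) := by
  intro m n
  have hpos : ∀ k, (0 : ℝ) < (psawFinset k).card := fun k =>
    Nat.cast_pos.2 (psawFinset_nonempty k).card_pos
  rw [← Real.log_mul (hpos m).ne' (hpos n).ne']
  exact Real.log_le_log (hpos _) (by exact_mod_cast card_psawFinset_add_le m n)

theorem log_card_psawFinset_mul_le (q : ℕ) {M : ℕ} (hM : 0 < M) :
    Real.log ((psawFinset (q * M)).card : ℝ) ≤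
      q * (Real.log 8 + Real.log ((neFinset M).card : ℝ)) +
      ((M + 1) * (M + 1) + (M + 2) + (M + 2) : ℕ) * (M * Real.log 4) := by
  have hpos : (0 : ℝ) < (psawFinset (q * M)).card :=
    Nat.cast_pos.2 (psawFinset_nonempty _).card_pos
  have ha : (0 : ℝ) < (neFinset M).card := Nat.cast_pos.2 (neFinset_nonempty M).card_pos
  have hle : ((psawFinset (q * M)).card : ℝ) ≤ (8 * (neFinset M).card) ^ q *
      (4 ^ M) ^ ((M + 1) * (M + 1) + (M + 2) + (M + 2)) := by
    have : ((psawFinset (q * M)).card : ℝ) ≤ 2 ^ q * ((4 * (neFinset M).card) ^ q *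
        (4 ^ M) ^ ((M + 1) * (M + 1) + (M + 2) + (M + 2))) := by
      exact_mod_cast card_psawFinset_mul_le q hM
    rwa [← mul_assoc, ← mul_pow, ← mul_assoc, show (2 : ℝ) * 4 = 8 by norm_num] at this
  refine (Real.log_le_log hpos hle).trans_eq ?_
  rw [Real.log_mul (by positivity) (by positivity), Real.log_pow, Real.log_pow, Real.log_pow,
    Real.log_mul (by norm_num) ha.ne']

theorem growth_rate_le_of_tendsto {c : ℝ}
    (hc : Tendsto (fun L : ℕ => Real.log ((psawFinset L).card : ℝ) / (L : ℝ)) atTop (nhds c))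
    {M : ℕ} (hM : 0 < M) :
    c ≤ (Real.log 8 + Real.log ((neFinset M).card : ℝ)) / M := by
  set K : ℝ := ((M + 1) * (M + 1) + (M + 2) + (M + 2) : ℕ) * (M * Real.log 4)
  have hM' : (0 : ℝ) < M := Nat.cast_pos.2 hM
  have hsub : Tendsto (fun q : ℕ => q * M) atTop atTop := tendsto_id.atTop_mul_const' hM
  have hlim : Tendsto (fun q : ℕ => (Real.log 8 + Real.log ((neFinset M).card : ℝ)) / M +
      K / M / q) atTop (nhds ((Real.log 8 + Real.log ((neFinset M).card : ℝ)) / M + 0)) :=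
    tendsto_const_nhds.add (tendsto_const_div_atTop_nhds_zero_nat _)
  rw [add_zero] at hlim
  refine le_of_tendsto_of_tendsto (hc.comp hsub) hlim ?_
  filter_upwards [eventually_gt_atTop 0] with q hq
  have hq' : (0 : ℝ) < q := Nat.cast_pos.2 hq
  have : Real.log ((psawFinset (q * M)).card : ℝ) ≤
      q * (Real.log 8 + Real.log ((neFinset M).card : ℝ)) + K := log_card_psawFinset_mul_le q hM
  clear_value K
  rw [Function.comp_apply, Nat.cast_mul, div_le_iff₀ (by positivity)]
  refine this.trans_eq ?_
  field_simp

/-- The exponential growth rates of the number of generic prudent paths and of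
NE (two-sided) prudent paths both exist and coincide. -/
theorem prudent_growth_rate_eq_NE_growth_rate :
    ∃ c : ℝ,
      Tendsto (fun L : ℕ => Real.log ((psawFinset L).card : ℝ) / (L : ℝ)) atTop (nhds c) ∧
      Tendsto (fun L : ℕ => Real.log ((neFinset L).card : ℝ) / (L : ℝ)) atTop (nhds c) := by
  have hbdd : BddBelow (Set.range fun L : ℕ => Real.log ((psawFinset L).card : ℝ) / (L : ℝ)) :=
    ⟨0, by rintro _ ⟨L, rfl⟩; exact div_nonneg (Real.log_natCast_nonneg _) L.cast_nonneg⟩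
  have hc := subadditive_log_card_psawFinset.tendsto_lim hbdd
  set c := subadditive_log_card_psawFinset.lim
  have hlow : Tendsto (fun L : ℕ => c - Real.log 8 / L) atTop (nhds (c - 0)) :=
    tendsto_const_nhds.sub (tendsto_const_div_atTop_nhds_zero_nat _)
  rw [sub_zero] at hlow
  refine ⟨c, hc, tendsto_of_tendsto_of_tendsto_of_le_of_le' hlow hc ?_ ?_⟩
  · filter_upwards [eventually_gt_atTop 0] with L hL
    have := growth_rate_le_of_tendsto hc hL
    rw [add_div] at this
    linarith
  · refine Eventually.of_forall fun L => ?_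
    have ha : (0 : ℝ) < (neFinset L).card := Nat.cast_pos.2 (neFinset_nonempty L).card_pos
    have := Finset.card_le_card (neFinset_subset_psawFinset L)
    gcongr
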